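/- Let p be an odd prime and let n be a positive integer such that √p ∈ ℚ(ζ_n), and let ℓ be an integer. Then there exist rational numbers a and b such that ∑_{j ∈ I_n^+} w_n^{jℓ} = a + b√p and ∑_{j ∈ I_n^-} w_n^{jℓ} = a - b√p. -/

import Mathlib

open IntermediateField

/-- `w n = e^{2πi/n}`, a primitive `n`-th root of unity in `ℂ`. -/
noncomputable def w (n : ℕ) : ℂ := Complex.exp (2 * Real.pi * Complex.I / n)

open scoped Classical in
/-- The index set `I_n^+` for an odd prime `p`: those `1 ≤ k ≤ n` coprime to `n` with
`((-1)^{(k-1)/2}·k / p) = 1`. -/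
noncomputable def Iplus (p n : ℕ) [Fact p.Prime] : Finset ℕ :=
  (Finset.Icc 1 n).filter fun k =>
    Nat.gcd k n = 1 ∧ legendreSym p ((-1) ^ ((k - 1) / 2) * (k : ℤ)) = 1

open scoped Classical in
/-- The index set `I_n^-` for an odd prime `p`: those `1 ≤ k ≤ n` coprime to `n` with
`((-1)^{(k-1)/2}·k / p) = -1`. -/
noncomputable def Iminus (p n : ℕ) [Fact p.Prime] : Finset ℕ :=
  (Finset.Icc 1 n).filter fun k =>
    Nat.gcd k n = 1 ∧ legendreSym p ((-1) ^ ((k - 1) / 2) * (k : ℤ)) = -1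

lemma aux_gauss {p : ℕ} [Fact p.Prime] (hp2 : p ≠ 2) {L M : Type*} [Field L] [CharZero L]
    [Field M] (ι τ : L →+* M) {ζ : L} (hζ : IsPrimitiveRoot ζ p) {m : ℕ}
    (hm : m.Coprime p) (hτ : τ ζ = ι ζ ^ m) :
    ∃ g : L, g ^ 2 = (legendreSym p (-1) : ℤ) * (p : L) ∧
      τ g = ((legendreSym p m : ℤ) : M) * ι g := by
  classical
  have hrc : ringChar (ZMod p) ≠ 2 := by rwa [ZMod.ringChar_zmod_n]
  let χ : MulChar (ZMod p) L := (quadraticChar (ZMod p)).ringHomComp (Int.castRingHom L)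
  let ψ : AddChar (ZMod p) L := AddChar.zmodChar p hζ.pow_eq_one
  have hχ : χ ≠ 1 := (MulChar.ringHomComp_ne_one_iff Int.cast_injective).2
    (quadraticChar_ne_one hrc)
  have hχ2 : χ.IsQuadratic := (quadraticChar_isQuadratic _).comp _
  have hψ : ψ.IsPrimitive := AddChar.zmodChar_primitive_of_primitive_root p hζ
  refine ⟨gaussSum χ ψ, ?_, ?_⟩
  · rw [gaussSum_sq hχ hχ2 hψ, ZMod.card]
    simp [χ, legendreSym]
  · have h1 := gaussSum_mulShift χ ψ (ZMod.unitOfCoprime m hm)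
    rw [ZMod.coe_unitOfCoprime] at h1
    have h2 : τ (gaussSum χ ψ) = ι (gaussSum χ (ψ.mulShift (m : ZMod p))) := by
      simp only [gaussSum, map_sum, map_mul]
      refine Finset.sum_congr rfl fun a _ => ?_
      congr 1
      · simp [χ]
      · have : (m : ZMod p) * a = ((m * a.val : ℕ) : ZMod p) := by simp
        rw [AddChar.mulShift_apply, this, AddChar.zmodChar_apply', AddChar.zmodChar_apply,
          map_pow, map_pow, hτ, pow_mul]
    have hu : (m : ZMod p) ≠ 0 := by
      rw [← ZMod.coe_unitOfCoprime m hm]; exact Units.ne_zero _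
    have h3 : χ (m : ZMod p) = ((legendreSym p m : ℤ) : L) := by simp [χ, legendreSym]
    have h4 : (legendreSym p m : ℤ) ^ 2 = 1 := legendreSym.sq_one p (by simpa using hu)
    rw [h2, ← h1, h3, map_mul, map_intCast, ← mul_assoc, ← Int.cast_mul, ← sq, h4]
    simp

/-- the sign -/
noncomputable def sgn (p m : ℕ) [Fact p.Prime] : ℤ :=
  legendreSym p ((-1) ^ ((m - 1) / 2) * (m : ℤ))

lemma sgn_one {p : ℕ} [Fact p.Prime] (h : p % 4 = 1) (m : ℕ) : sgn p m = legendreSym p m := by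
  have h1 : legendreSym p (-1) = 1 := by
    rw [legendreSym.at_neg_one (by omega), ZMod.χ₄_nat_one_mod_four h]
  have := map_pow (legendreSym.hom p) (-1) ((m - 1) / 2)
  simp only [legendreSym.hom_apply] at this
  rw [sgn, legendreSym.mul, this, h1]; simp

lemma sgn_three {p : ℕ} [Fact p.Prime] (h : p % 4 = 3) (m : ℕ) :
    sgn p m = (-1) ^ ((m - 1) / 2) * legendreSym p m := by
  have h1 : legendreSym p (-1) = -1 := by
    rw [legendreSym.at_neg_one (by omega), ZMod.χ₄_nat_three_mod_four h]
  have := map_pow (legendreSym.hom p) (-1) ((m - 1) / 2)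
  simp only [legendreSym.hom_apply] at this
  rw [sgn, legendreSym.mul, this, h1]

lemma aux_key {p : ℕ} [Fact p.Prime] {L M : Type*} [Field L] [CharZero L]
    [Field M] (ι τ : L →+* M) {N : ℕ} (hN : 0 < N) {ζ : L} (hζ : IsPrimitiveRoot ζ N) {m : ℕ}
    (hm : m.Coprime N) (hτ : τ ζ = ι ζ ^ m) (hpN : p ∣ N)
    (h4 : p % 4 = 1 ∨ (p % 4 = 3 ∧ 4 ∣ N)) {s : L} (hs : s ^ 2 = p) :
    τ s = ((sgn p m : ℤ) : M) * ι s := by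
  have hp2 : p ≠ 2 := by omega
  obtain ⟨c, hc⟩ := hpN
  obtain ⟨g, hg, hg'⟩ := aux_gauss (p := p) hp2 ι τ
    (hζ.pow hN (by rw [hc, mul_comm]) : IsPrimitiveRoot (ζ ^ c) p)
    (Nat.Coprime.coprime_dvd_right ⟨c, hc⟩ hm) (by
      rw [map_pow, map_pow, hτ, ← pow_mul, ← pow_mul, mul_comm])
  rcases h4 with h | ⟨h, d, hd⟩
  · rw [legendreSym.at_neg_one hp2, ZMod.χ₄_nat_one_mod_four h] at hg
    rw [sgn_one h]
    have : s ^ 2 = g ^ 2 := by rw [hs, hg]; simp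
    rcases sq_eq_sq_iff_eq_or_eq_neg.1 this with rfl | rfl
    · exact hg'
    · rw [map_neg, map_neg, hg']; ring
  · rw [legendreSym.at_neg_one hp2, ZMod.χ₄_nat_three_mod_four h] at hg
    rw [sgn_three h]
    have hi : IsPrimitiveRoot (ζ ^ d) 4 := hζ.pow hN (by rw [hd, mul_comm])
    have hi2 : (ζ ^ d) ^ 2 = -1 := by
      have := hi.pow (a := 2) (b := 2) (by norm_num) (by norm_num)
      exact this.eq_neg_one_of_two_right
    set i := ζ ^ d with hidef
    have hodd : m % 2 = 1 := by
      have : m.Coprime 2 := Nat.Coprime.coprime_dvd_right ⟨2 * d, by rw [hd]; ring⟩ hm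
      exact Nat.odd_iff.1 (Nat.coprime_two_right.1 this)
    have hti : τ i = (-1) ^ ((m - 1) / 2) * ι i := by
      have h1 : τ i = (ι i) ^ m := by
        rw [hidef, map_pow, map_pow, hτ, ← pow_mul, ← pow_mul, mul_comm]
      have h2 : (ι i) ^ 2 = -1 := by rw [← map_pow, hi2]; simp
      have h3 : m = 2 * ((m - 1) / 2) + 1 := by omega
      rw [h1, ← h2, ← pow_mul, ← pow_succ, ← h3]
    have : s ^ 2 = (i * g) ^ 2 := by rw [mul_pow, hs, hg, hi2]; simp
    have hg2 : τ (i * g) = (((-1) ^ ((m - 1) / 2) * legendreSym p m : ℤ) : M) * ι (i * g) := by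
      rw [map_mul, map_mul, hti, hg']; push_cast; ring
    rcases sq_eq_sq_iff_eq_or_eq_neg.1 this with h | h
    · rw [h]; exact hg2
    · rw [h, map_neg, map_neg, hg2]; ring

lemma w_prim {n : ℕ} (hn : 0 < n) : IsPrimitiveRoot (w n) n :=
  Complex.isPrimitiveRoot_exp n hn.ne'

lemma w_int {n : ℕ} (hn : 0 < n) : IsIntegral ℚ (w n) :=
  ((w_prim hn).isIntegral hn).tower_top

lemma exists_emb {n : ℕ} (hn : 0 < n) {m : ℕ} (hm : m.Coprime n) :
    ∃ τ : ℚ⟮w n⟯ →ₐ[ℚ] ℂ, τ (AdjoinSimple.gen ℚ (w n)) = w n ^ m := by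
  have h : w n ^ m ∈ (minpoly ℚ (w n)).aroots ℂ := by
    rw [← Polynomial.cyclotomic_eq_minpoly_rat (w_prim hn) hn,
      Polynomial.cyclotomic_eq_minpoly_rat ((w_prim hn).pow_of_coprime m hm) hn,
      Polynomial.mem_aroots]
    exact ⟨minpoly.ne_zero ((w_int hn).pow m), minpoly.aeval _ _⟩
  exact ⟨(algHomAdjoinIntegralEquiv ℚ (w_int hn)).symm ⟨_, h⟩,
    algHomAdjoinIntegralEquiv_symm_apply_gen ℚ (w_int hn) ⟨_, h⟩⟩

lemma gen_prim {n : ℕ} (hn : 0 < n) : IsPrimitiveRoot (AdjoinSimple.gen ℚ (w n)) n := by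
  apply IsPrimitiveRoot.of_map_of_injective (f := (ℚ⟮w n⟯).val) _ (ℚ⟮w n⟯).val.injective
  simpa using w_prim hn

lemma sqrt_sq (p : ℕ) : ((Real.sqrt p : ℝ) : ℂ) ^ 2 = p := by
  rw [← Complex.ofReal_pow, Real.sq_sqrt (Nat.cast_nonneg p)]; simp

lemma sqrt_ne (p : ℕ) [Fact p.Prime] : ((Real.sqrt p : ℝ) : ℂ) ≠ 0 := by
  intro h
  have := sqrt_sq p
  rw [h] at this
  have hp := (Fact.out : p.Prime).ne_zero
  simp at this
  exact hp (by exact_mod_cast this.symm)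

lemma aux_div {p n : ℕ} [Fact p.Prime] (hp2 : p ≠ 2) (hn : 0 < n)
    (hs : ((Real.sqrt p : ℝ) : ℂ) ∈ ℚ⟮w n⟯) {m : ℕ} (hm : m.Coprime (4 * p * n))
    (hm1 : m ≡ 1 [MOD n]) : sgn p m = 1 := by
  have hp := (Fact.out : p.Prime)
  have hN : 0 < 4 * p * n := by have := hp.pos; positivity
  obtain ⟨τ, hτ⟩ := exists_emb hN hm
  have hw : w n = w (4 * p * n) ^ (4 * p) := by
    have := hp.ne_zero
    rw [w, w, ← Complex.exp_nat_mul]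
    congr 1
    have : (p : ℂ) ≠ 0 := by exact_mod_cast this
    have : (n : ℂ) ≠ 0 := by exact_mod_cast hn.ne'
    push_cast
    field_simp
  have hle : ℚ⟮w n⟯ ≤ ℚ⟮w (4 * p * n)⟯ := by
    rw [adjoin_simple_le_iff, hw]
    exact pow_mem (mem_adjoin_simple_self ℚ _) _
  have hcomp : τ.comp (inclusion hle) = (ℚ⟮w n⟯).val := by
    apply adjoin_algHom_ext
    intro x hx
    rw [Set.mem_singleton_iff] at hx
    subst hx
    have : inclusion hle ⟨w n, mem_adjoin_simple_self ℚ _⟩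
        = (AdjoinSimple.gen ℚ (w (4 * p * n))) ^ (4 * p) := by
      apply Subtype.ext
      simpa using hw
    change τ (inclusion hle ⟨w n, mem_adjoin_simple_self ℚ _⟩) = w n
    rw [this, map_pow, hτ, ← pow_mul, mul_comm m, pow_mul, ← hw]
    rw [pow_eq_pow_mod m (w_prim hn).pow_eq_one, show m % n = 1 % n from hm1,
      ← pow_eq_pow_mod 1 (w_prim hn).pow_eq_one, pow_one]
  have e := aux_key (p := p) (ℚ⟮w (4 * p * n)⟯).val.toRingHom τ.toRingHom hN (gen_prim hN) hm
    (by simpa using hτ) ⟨4 * n, by ring⟩ (by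
      have := hp.eq_two_or_odd
      have : 4 ∣ 4 * p * n := ⟨p * n, by ring⟩
      omega) (s := inclusion hle ⟨_, hs⟩) (by
        apply Subtype.ext
        simpa using sqrt_sq p)
  have e2 : τ (inclusion hle ⟨_, hs⟩) = ((Real.sqrt p : ℝ) : ℂ) := DFunLike.congr_fun hcomp ⟨_, hs⟩
  have e3 : ((Real.sqrt p : ℝ) : ℂ) = ((sgn p m : ℤ) : ℂ) * ((Real.sqrt p : ℝ) : ℂ) := by
    have := e2.symm.trans e
    simpa using this
  have e4 : ((sgn p m : ℤ) : ℂ) = 1 := by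
    have := sqrt_ne p
    field_simp at e3
    exact e3.symm
  exact_mod_cast e4

lemma p_dvd {p n : ℕ} [Fact p.Prime] (hp2 : p ≠ 2) (hn : 0 < n)
    (hs : ((Real.sqrt p : ℝ) : ℂ) ∈ ℚ⟮w n⟯) : p ∣ n := by
  classical
  by_contra hpn
  have hp := (Fact.out : p.Prime)
  have hodd := hp.eq_two_or_odd
  have hrc : ringChar (ZMod p) ≠ 2 := by rwa [ZMod.ringChar_zmod_n]
  obtain ⟨a, ha⟩ := quadraticChar_exists_neg_one hrc
  have ha0 : a ≠ 0 := by rintro rfl; simp at ha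
  have hcop : (4 * n).Coprime p := by
    apply Nat.Coprime.symm
    rw [hp.coprime_iff_not_dvd, hp.dvd_mul]
    rintro (h | h)
    · have h2 : p ∣ 2 ^ 2 := by simpa using h
      exact hp2 ((Nat.prime_dvd_prime_iff_eq hp Nat.prime_two).1 (hp.dvd_of_dvd_pow h2))
    · exact hpn h
  obtain ⟨m, hm1, hm2⟩ := Nat.chineseRemainder hcop 1 a.val
  have hma : (m : ZMod p) = a := by
    rw [(ZMod.natCast_eq_natCast_iff _ _ _).2 hm2]; simp
  have hmp : m.Coprime p := by
    rw [← ZMod.isUnit_iff_coprime, hma]; exact ha0.isUnit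
  have hm4n : m.Coprime (4 * n) := by
    have := hm1.gcd_eq
    simpa [Nat.Coprime] using this
  have h := aux_div hp2 hn hs (m := m) (by
      rw [show 4 * p * n = 4 * n * p by ring]
      exact Nat.Coprime.mul_right hm4n hmp) (hm1.of_mul_left 4)
  have hl : legendreSym p m = -1 := by
    rw [legendreSym]; simpa [hma] using ha
  have hm4 : m % 4 = 1 := by
    have := hm1.of_mul_right n
    exact this
  rcases (by omega : p % 4 = 1 ∨ p % 4 = 3) with h4 | h4
  · rw [sgn_one h4, hl] at h; omega
  · rw [sgn_three h4, hl, Even.neg_one_pow (by rw [Nat.even_iff]; omega)] at h; omega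

lemma four_dvd {p n : ℕ} [Fact p.Prime] (hp2 : p ≠ 2) (hn : 0 < n)
    (hs : ((Real.sqrt p : ℝ) : ℂ) ∈ ℚ⟮w n⟯) (h3 : p % 4 = 3) : 4 ∣ n := by
  by_contra h4
  have hpn := p_dvd hp2 hn hs
  obtain ⟨m, c, hm, hm4⟩ : ∃ m c, m = 1 + c * n ∧ m % 4 = 3 := by
    rcases (by omega : n % 2 = 1 ∨ n % 4 = 2) with h | h
    · exact ⟨1 + 2 * n, 2, rfl, by omega⟩
    · exact ⟨1 + 1 * n, 1, rfl, by omega⟩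
  have hmn : m.Coprime n := by rw [hm]; simp
  have hmp : m.Coprime p := Nat.Coprime.coprime_dvd_right hpn hmn
  have hm2 : m.Coprime 4 := by
    have : m.Coprime 2 := Nat.coprime_two_right.2 (Nat.odd_iff.2 (by omega))
    exact this.pow_right 2
  have h := aux_div hp2 hn hs (m := m) ((hm2.mul_right hmp).mul_right hmn) (by
    rw [hm]; simp [Nat.ModEq])
  have hl : legendreSym p m = 1 := by
    obtain ⟨d, rfl⟩ := hpn
    have : (m : ZMod p) = 1 := by rw [hm]; simp
    rw [legendreSym]; simp [this]
  rw [sgn_three h3, hl, Odd.neg_one_pow (by rw [Nat.odd_iff]; omega)] at h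
  omega

lemma trace_sum {n : ℕ} (hn : 1 < n) (x : ℚ⟮w n⟯) (f : ℕ → ℂ)
    (hf : ∀ k, k.Coprime n → ∀ τ : ℚ⟮w n⟯ →ₐ[ℚ] ℂ, 
      τ (AdjoinSimple.gen ℚ (w n)) = w n ^ k → τ x = f k) :
    ∃ t : ℚ, ∑ k ∈ (Finset.Icc 1 n).filter (fun k => Nat.gcd k n = 1), f k = (t : ℂ) := by
  have hn0 : 0 < n := by omega
  have : NeZero n := ⟨by omega⟩
  have := adjoin.finiteDimensional (w_int hn0)
  refine ⟨Algebra.trace ℚ ℚ⟮w n⟯ x, ?_⟩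
  have := trace_eq_sum_embeddings ℂ (K := ℚ) (L := ℚ⟮w n⟯) (x := x)
  rw [eq_ratCast] at this
  rw [this]
  have hlt : ∀ k ∈ (Finset.Icc 1 n).filter (fun k => Nat.gcd k n = 1), k < n := by
    intro k hk
    simp only [Finset.mem_filter, Finset.mem_Icc] at hk
    rcases hk.1.2.lt_or_eq with h | h
    · exact h
    · rw [h, Nat.gcd_self] at hk; omega
  refine Finset.sum_bij (fun k hk => (exists_emb hn0 (m := k) (Finset.mem_filter.1 hk).2).choose)
    (fun _ _ => Finset.mem_univ _) ?_ ?_ ?_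
  · intro a ha b hb hab
    have h1 := (exists_emb hn0 (m := a) (Finset.mem_filter.1 ha).2).choose_spec
    have h2 := (exists_emb hn0 (m := b) (Finset.mem_filter.1 hb).2).choose_spec
    rw [hab] at h1
    exact (w_prim hn0).pow_inj (hlt a ha) (hlt b hb) (h1.symm.trans h2)
  · intro τ _
    have hp : IsPrimitiveRoot (τ (AdjoinSimple.gen ℚ (w n))) n :=
      (gen_prim hn0).map_of_injective τ.injective
    obtain ⟨i, hi, hic, hiw⟩ := (w_prim hn0).isPrimitiveRoot_iff.1 hp
    have hi0 : i ≠ 0 := by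
      rintro rfl
      rw [Nat.coprime_zero_left] at hic; omega
    have hmem : i ∈ (Finset.Icc 1 n).filter (fun k => Nat.gcd k n = 1) := by
      simp only [Finset.mem_filter, Finset.mem_Icc]
      exact ⟨⟨by omega, hi.le⟩, hic⟩
    refine ⟨i, hmem, ?_⟩
    have h1 := (exists_emb hn0 (m := i) (Finset.mem_filter.1 hmem).2).choose_spec
    apply adjoin_algHom_ext
    intro y hy
    rw [Set.mem_singleton_iff] at hy
    subst hy
    exact h1.trans hiw
  · intro k hk
    exact (hf k (Finset.mem_filter.1 hk).2 _
      (exists_emb hn0 (m := k) (Finset.mem_filter.1 hk).2).choose_spec).symm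

/-- Let `p` be an odd prime and `n` a positive integer with `√p ∈ ℚ(ζ_n)`, and let `ℓ ∈ ℤ`.
Then there are rationals `a, b` with `∑_{j ∈ I_n^+} w_n^{jℓ} = a + b√p` and
`∑_{j ∈ I_n^-} w_n^{jℓ} = a - b√p`. -/
theorem sum_over_index_sets (p n : ℕ) [Fact p.Prime] (hp2 : p ≠ 2) (hn : 0 < n)
    (hs : ((Real.sqrt p : ℝ) : ℂ) ∈ ℚ⟮w n⟯) (ℓ : ℤ) :
    ∃ a b : ℚ,
      ∑ j ∈ Iplus p n, w n ^ ((j : ℤ) * ℓ) =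
        (a : ℂ) + (b : ℂ) * ((Real.sqrt p : ℝ) : ℂ) ∧
      ∑ j ∈ Iminus p n, w n ^ ((j : ℤ) * ℓ) =
        (a : ℂ) - (b : ℂ) * ((Real.sqrt p : ℝ) : ℂ) := by
  have hp := (Fact.out : p.Prime)
  have hodd := hp.eq_two_or_odd
  have hpn := p_dvd hp2 hn hs
  have hn1 : 1 < n := lt_of_lt_of_le hp.one_lt (Nat.le_of_dvd hn hpn)
  have h4 : p % 4 = 1 ∨ (p % 4 = 3 ∧ 4 ∣ n) := by
    rcases (by omega : p % 4 = 1 ∨ p % 4 = 3) with h | h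
    · exact Or.inl h
    · exact Or.inr ⟨h, four_dvd hp2 hn hs h⟩
  let G := AdjoinSimple.gen ℚ (w n)
  have hG : ∀ k : ℕ, ∀ τ : ℚ⟮w n⟯ →ₐ[ℚ] ℂ, τ G = w n ^ k → τ (G ^ ℓ) = w n ^ ((k : ℤ) * ℓ) := by
    intro k τ hτ
    rw [map_zpow₀, hτ, zpow_mul, zpow_natCast]
  obtain ⟨t, ht⟩ := trace_sum hn1 (G ^ ℓ) (fun k => w n ^ ((k : ℤ) * ℓ)) fun k _ τ hτ => hG k τ hτ
  obtain ⟨u, hu⟩ := trace_sum hn1 (⟨_, hs⟩ * G ^ ℓ)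
    (fun k => ((sgn p k : ℤ) : ℂ) * ((Real.sqrt p : ℝ) : ℂ) * w n ^ ((k : ℤ) * ℓ)) (by
      intro k hk τ hτ
      rw [map_mul, hG k τ hτ]
      congr 1
      have e := aux_key (p := p) (ℚ⟮w n⟯).val.toRingHom τ.toRingHom hn (gen_prim hn) hk
        (by simpa using hτ) hpn h4 (s := ⟨_, hs⟩) (by
          apply Subtype.ext
          simpa using sqrt_sq p)
      simpa using e)
  set S := (Finset.Icc 1 n).filter (fun k => Nat.gcd k n = 1) with hS
  have hsgn : ∀ k ∈ S, sgn p k = 1 ∨ sgn p k = -1 := by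
    intro k hk
    have hk' : k.Coprime n := (Finset.mem_filter.1 hk).2
    have hu : IsUnit (k : ZMod p) :=
      (ZMod.isUnit_iff_coprime k p).2 (hk'.coprime_dvd_right hpn)
    refine legendreSym.eq_one_or_neg_one p ?_
    push_cast
    exact mul_ne_zero (pow_ne_zero _ (neg_ne_zero.2 one_ne_zero)) hu.ne_zero
  have hP : Iplus p n = S.filter (fun k => sgn p k = 1) := by
    ext k; simp [Iplus, hS, sgn, and_assoc]
  have hM : Iminus p n = S.filter (fun k => ¬ sgn p k = 1) := by
    ext k
    constructor
    · intro hk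
      simp only [Iminus, Finset.mem_filter] at hk
      rw [Finset.mem_filter, hS, Finset.mem_filter]
      refine ⟨⟨hk.1, hk.2.1⟩, ?_⟩
      rw [sgn, hk.2.2]; decide
    · intro hk
      rw [Finset.mem_filter] at hk
      have h := (hsgn k hk.1).resolve_left hk.2
      rw [hS, Finset.mem_filter] at hk
      simp only [Iminus, Finset.mem_filter]
      exact ⟨hk.1.1, hk.1.2, h⟩
  rw [hP, hM]
  rw [← Finset.sum_filter_add_sum_filter_not S (fun k => sgn p k = 1)] at ht hu
  have e1 : ∑ k ∈ S.filter (fun k => sgn p k = 1),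
      ((sgn p k : ℤ) : ℂ) * ((Real.sqrt p : ℝ) : ℂ) * w n ^ ((k : ℤ) * ℓ) =
      ((Real.sqrt p : ℝ) : ℂ) * ∑ k ∈ S.filter (fun k => sgn p k = 1), w n ^ ((k : ℤ) * ℓ) := by
    rw [Finset.mul_sum]
    refine Finset.sum_congr rfl fun k hk => ?_
    rw [(Finset.mem_filter.1 hk).2]; simp
  have e2 : ∑ k ∈ S.filter (fun k => ¬ sgn p k = 1),
      ((sgn p k : ℤ) : ℂ) * ((Real.sqrt p : ℝ) : ℂ) * w n ^ ((k : ℤ) * ℓ) =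
      -(((Real.sqrt p : ℝ) : ℂ) *
        ∑ k ∈ S.filter (fun k => ¬ sgn p k = 1), w n ^ ((k : ℤ) * ℓ)) := by
    rw [Finset.mul_sum, ← Finset.sum_neg_distrib]
    refine Finset.sum_congr rfl fun k hk => ?_
    rw [Finset.mem_filter] at hk
    rw [(hsgn k hk.1).resolve_left hk.2]; simp
  rw [e1, e2] at hu
  have hr := sqrt_sq p
  have hr0 := sqrt_ne p
  generalize ((Real.sqrt p : ℝ) : ℂ) = r at *
  generalize ∑ k ∈ S.filter (fun k => sgn p k = 1), w n ^ ((k : ℤ) * ℓ) = A at *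
  generalize ∑ k ∈ S.filter (fun k => ¬ sgn p k = 1), w n ^ ((k : ℤ) * ℓ) = B at *
  have hb : ((u / (2 * p) : ℚ) : ℂ) * r = (A - B) / 2 := by
    push_cast
    rw [← hr, ← hu]
    field_simp
    ring
  refine ⟨t / 2, u / (2 * p), ?_, ?_⟩
  · rw [hb]; push_cast; rw [← ht]; ring
  · rw [hb]; push_cast; rw [← ht]; ring
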